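/- Let f ∈ F. Assume that either Y is discrete, or b is continuous in the second variable and f(y) > −∞ for all y ∈ Y. Then: (a) if f ∈ F_c, the family {∂f(y)}_{y∈ldom f} is a covering of udom(Bf); (b) if b is coercive, the family {∂f(y)}_{y∈ldom f} is a covering of idom(Bf). -/

import Mathlib

noncomputable def Bop {X Y : Type*} (b : X → Y → EReal → EReal) (f : Y → EReal) : X → EReal :=
  fun x => ⨆ y, b x y (f y)

noncomputable def Bgal {X Y : Type*} (bo : Y → X → EReal → EReal) (g : X → EReal) : Y → EReal :=
  fun y => ⨆ x, bo y x (g x)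

/-- Subdifferential of `f` at `y` with respect to the kernel `b`. -/
def subdiff {X Y : Type*} (b : X → Y → EReal → EReal) (S : Set (X × Y))
    (f : Y → EReal) (y : Y) : Set X :=
  {x | (x, y) ∈ S ∧ Bop b f x = b x y (f y)}

/-- Subdifferential of `g` at `x` with respect to the kernel `b°`. -/
def subdiffo {X Y : Type*} (bo : Y → X → EReal → EReal) (S : Set (X × Y))
    (g : X → EReal) (x : X) : Set Y :=
  {y | (x, y) ∈ S ∧ Bgal bo g y = bo y x (g x)}

/-- `(∂°g)⁻¹(y)`. -/
def subdiffoInv {X Y : Type*} (bo : Y → X → EReal → EReal) (S : Set (X × Y))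
    (g : X → EReal) (y : Y) : Set X :=
  {x | y ∈ subdiffo bo S g x}

def ldom {Z : Type*} (h : Z → EReal) : Set Z := {z | h z < ⊤}
def udom {Z : Type*} (h : Z → EReal) : Set Z := {z | ⊥ < h z}
def edom {Z : Type*} (h : Z → EReal) : Set Z := ldom h ∩ udom h
def idom {Z : Type*} [TopologicalSpace Z] (h : Z → EReal) : Set Z :=
  {z | z ∈ edom h ∧ Filter.limsup h (nhds z) < ⊤}

/-- `b` is continuous in the second variable. -/
def Cont2 {X Y : Type*} [TopologicalSpace Y] (b : X → Y → EReal → EReal) : Prop :=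
  ∀ (x : X) (α : ℝ), Continuous fun y => b x y (α : EReal)

/-- `b` is coercive. -/
def Coercive {X Y : Type*} [TopologicalSpace X] [TopologicalSpace Y]
    (b : X → Y → EReal → EReal) (bo : Y → X → EReal → EReal) : Prop :=
  ∀ x : X, ∀ V ∈ nhds x, ∀ (α β : ℝ),
    IsCompact (closure {y : Y | (⨆ z ∈ V, b z y (bo y x (α : EReal))) ≤ (β : EReal)})

/-- `f ∈ F_c`: relatively compact finite superlevel sets. -/
def MemFc {X Y : Type*} [TopologicalSpace Y] (b : X → Y → EReal → EReal)
    (f : Y → EReal) : Prop :=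
  ∀ (x : X) (β : ℝ), IsCompact (closure {y : Y | (β : EReal) ≤ b x y (f y)})

/-- `f` solves Problem (P') for the data `g`, `X'`. -/
def IsSolution {X Y : Type*} [TopologicalSpace Y] (b : X → Y → EReal → EReal)
    (g : X → EReal) (X' : Set X) (f : Y → EReal) : Prop :=
  LowerSemicontinuous f ∧ (∀ x, Bop b f x ≤ g x) ∧ ∀ x ∈ X', Bop b f x = g x

def SemiOpen {Z : Type*} [TopologicalSpace Z] (s : Set Z) : Prop :=
  s ⊆ closure (interior s)

def QuasiContinuous {Z W : Type*} [TopologicalSpace Z] [TopologicalSpace W]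
    (h : Z → W) : Prop :=
  ∀ G : Set W, IsOpen G → SemiOpen (h ⁻¹' G)

/-- `h` is quasi-continuous on its domain. -/
def QuasiContinuousOnDom {Z : Type*} [TopologicalSpace Z] (h : Z → EReal) : Prop :=
  QuasiContinuous fun z : edom h => h z.1

/-- `y` is algebraically essential with respect to the covering of `W'` by `{Fm z}_{z ∈ Z'}`. -/
def AlgEssential {Z W : Type*} (Fm : Z → Set W) (Z' : Set Z) (W' : Set W) (y : Z) : Prop :=
  y ∈ Z' ∧ ∃ w ∈ W', ∀ z ∈ Z' \ {y}, w ∉ Fm z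

/-- `y` is topologically essential with respect to the covering of `W'` by `{Fm z}_{z ∈ Z'}`. -/
def TopEssential {Z W : Type*} [TopologicalSpace Z] (Fm : Z → Set W) (Z' : Set Z)
    (W' : Set W) (y : Z) : Prop :=
  y ∈ Z' ∧ ∀ U : Set Z, IsOpen U → y ∈ U → ∃ w ∈ W', ∀ z ∈ Z' \ U, w ∉ Fm z

theorem kernel_antitone {X Y : Type*} {b : X → Y → EReal → EReal} {bo : Y → X → EReal → EReal}
    (hgal : ∀ (x : X) (y : Y) (α β : EReal), b x y α ≤ β ↔ bo y x β ≤ α) (x : X) (y : Y) :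
    Antitone (b x y) := fun _ _ h =>
  (hgal x y _ _).2 (((hgal x y _ _).1 le_rfl).trans h)

theorem kernel_top {X Y : Type*} {b : X → Y → EReal → EReal} {bo : Y → X → EReal → EReal}
    (hgal : ∀ (x : X) (y : Y) (α β : EReal), b x y α ≤ β ↔ bo y x β ≤ α) (x : X) (y : Y) :
    b x y ⊤ = ⊥ :=
  le_bot_iff.1 ((hgal x y _ _).2 le_top)

/-- On a pair where the kernel is bijective, `b°` inverts `b`. -/
theorem le_dual_kernel_of_le {X Y : Type*} {b : X → Y → EReal → EReal}
    {bo : Y → X → EReal → EReal}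
    (hgal : ∀ (x : X) (y : Y) (α β : EReal), b x y α ≤ β ↔ bo y x β ≤ α) {x : X} {y : Y}
    (hbij : Function.Bijective (b x y)) {α β : EReal} (h : β ≤ b x y α) : α ≤ bo y x β := by
  by_contra! hlt
  have hle : b x y (bo y x β) ≤ β := (hgal x y _ _).2 le_rfl
  have hanti := kernel_antitone hgal x y hlt.le
  exact hlt.ne (hbij.1 (le_antisymm (hle.trans h) hanti))

theorem upperSemicontinuous_kernel_comp {X Y : Type*} [TopologicalSpace Y]
    {b : X → Y → EReal → EReal} {bo : Y → X → EReal → EReal} {S : Set (X × Y)}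
    (hgal : ∀ (x : X) (y : Y) (α β : EReal), b x y α ≤ β ↔ bo y x β ≤ α)
    (hS3 : ∀ x y, (x, y) ∈ S → Function.Bijective (b x y))
    (hS4 : ∀ x y, (x, y) ∉ S → ∀ α : EReal, b x y α = ⊥)
    {f : Y → EReal} (hf : LowerSemicontinuous f)
    (ha : DiscreteTopology Y ∨ (Cont2 b ∧ ∀ y : Y, f y ≠ ⊥)) (x : X) :
    UpperSemicontinuous fun y => b x y (f y) := by
  rcases ha with hd | ⟨hc, hbot⟩
  · exact continuous_of_discreteTopology.upperSemicontinuous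
  intro y₀ β hβ
  obtain ⟨α, hα, hαβ⟩ : ∃ α : ℝ, (α : EReal) < f y₀ ∧ b x y₀ α < β := by
    by_cases hS : (x, y₀) ∈ S
    · obtain ⟨β', h₁, h₂⟩ := exists_between hβ
      obtain ⟨γ, rfl⟩ := (hS3 x y₀ hS).2 β'
      have hγ : γ < f y₀ := by
        by_contra! h
        exact (kernel_antitone hgal x y₀ h).not_gt h₁
      obtain ⟨α, hγα, hα⟩ := EReal.lt_iff_exists_real_btwn.1 hγ
      exact ⟨α, hα, (kernel_antitone hgal x y₀ hγα.le).trans_lt h₂⟩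
    · obtain ⟨α, -, hα⟩ := EReal.lt_iff_exists_real_btwn.1 (bot_lt_iff_ne_bot.2 (hbot y₀))
      refine ⟨α, hα, ?_⟩
      rw [hS4 x y₀ hS]
      exact bot_le.trans_lt hβ
  filter_upwards [hf y₀ α hα, (hc x α).continuousAt.eventually_lt_const hαβ] with y h₁ h₂
  exact (kernel_antitone hgal x y h₁.le).trans_lt h₂

theorem exists_eq_iSup_of_isCompact_closure {Y : Type*} [TopologicalSpace Y] {h : Y → EReal}
    (hh : UpperSemicontinuous h) {β : EReal} (hβ : β < ⨆ y, h y)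
    (hK : IsCompact (closure {y | β ≤ h y})) : ∃ y, ⨆ z, h z = h y := by
  obtain ⟨y₀, hy₀⟩ := lt_iSup_iff.1 hβ
  obtain ⟨y, -, hmax⟩ := (hh.upperSemicontinuousOn _).exists_isMaxOn
    ⟨y₀, subset_closure (show y₀ ∈ {y | β ≤ h y} from hy₀.le)⟩ hK
  refine ⟨y, le_antisymm (iSup_le fun z => ?_) (le_iSup h y)⟩
  by_cases hz : β ≤ h z
  · exact hmax (subset_closure hz)
  · exact (not_le.1 hz).le.trans
      (hy₀.le.trans (hmax (subset_closure (show y₀ ∈ {y | β ≤ h y} from hy₀.le))))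

/-- Covering of `udom(Bf)` (resp. `idom(Bf)`) by the subdifferentials of `f`. -/
theorem stmt11
    {X Y : Type*} [TopologicalSpace X] [TopologicalSpace Y] [T2Space X] [T2Space Y]
    (b : X → Y → EReal → EReal) (bo : Y → X → EReal → EReal) (S : Set (X × Y))
    (hgal : ∀ (x : X) (y : Y) (α β : EReal), b x y α ≤ β ↔ bo y x β ≤ α)
    (hbo_lsc : ∀ (x : X) (α : EReal), LowerSemicontinuous fun y => bo y x α)
    (hS1 : ∀ x : X, ∃ y : Y, (x, y) ∈ S)
    (hS2 : ∀ y : Y, ∃ x : X, (x, y) ∈ S)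
    (hS3 : ∀ x y, (x, y) ∈ S → Function.Bijective (b x y))
    (hS4 : ∀ x y, (x, y) ∉ S → ∀ α : EReal, b x y α = ⊥)
    (f : Y → EReal) (hf : LowerSemicontinuous f)
    (ha : DiscreteTopology Y ∨ (Cont2 b ∧ ∀ y : Y, f y ≠ ⊥)) :
    (MemFc b f → udom (Bop b f) ⊆ ⋃ y ∈ ldom f, subdiff b S f y) ∧
    (Coercive b bo → idom (Bop b f) ⊆ ⋃ y ∈ ldom f, subdiff b S f y) := by
  have key : ∀ x, ∀ β : ℝ, (β : EReal) < Bop b f x →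
      IsCompact (closure {y : Y | (β : EReal) ≤ b x y (f y)}) →
      x ∈ ⋃ y ∈ ldom f, subdiff b S f y := by
    intro x β hβ hK
    obtain ⟨y, hy⟩ := exists_eq_iSup_of_isCompact_closure
      (upperSemicontinuous_kernel_comp hgal hS3 hS4 hf ha x) hβ hK
    have hne : b x y (f y) ≠ ⊥ := hy ▸ (bot_le.trans_lt hβ).ne'
    refine Set.mem_biUnion (x := y) ?_ ⟨?_, hy⟩
    · exact lt_top_iff_ne_top.2 fun h : f y = ⊤ => hne (by rw [h, kernel_top hgal])
    · by_contra h
      exact hne (hS4 x y h _)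
  refine ⟨fun hfc x hx => ?_, fun hco x hx => ?_⟩
  · obtain ⟨β, -, hβ⟩ := EReal.lt_iff_exists_real_btwn.1 hx
    exact key x β hβ (hfc x β)
  · obtain ⟨⟨-, hx⟩, hlim⟩ := hx
    obtain ⟨α, -, hα⟩ := EReal.lt_iff_exists_real_btwn.1 hx
    obtain ⟨M, hM, -⟩ := EReal.lt_iff_exists_real_btwn.1 hlim
    have hV : {z | Bop b f z < M} ∈ nhds x := Filter.eventually_lt_of_limsup_lt hM
    refine key x α hα ((hco x _ hV α M).of_isClosed_subset isClosed_closure (closure_mono ?_))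
    intro y hy
    have hyS : (x, y) ∈ S := by
      by_contra h
      have hy' : (α : EReal) ≤ b x y (f y) := hy
      rw [hS4 x y h] at hy'
      exact (EReal.bot_lt_coe α).not_ge hy'
    rw [Set.mem_ofPred_eq]
    refine iSup₂_le fun z hz => ?_
    calc b z y (bo y x α) ≤ b z y (f y) :=
          kernel_antitone hgal z y (le_dual_kernel_of_le hgal (hS3 x y hyS) hy)
      _ ≤ Bop b f z := le_iSup (fun y => b z y (f y)) y
      _ ≤ M := le_of_lt hz
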